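/- Let D = (d, T) with d = (d_1, …, d_n), M = Σ_i d_i even and M ≥ 4, and T ≥ 1, and sample a temporal configuration of D uniformly at random. Then the expected number of unordered pairs {e, e'} of distinct matched pairs such that, for some i, all four points of e and e' lie in the same cell P_i and e and e' are assigned the same timestamp (i.e., the expected number of temporal double-loops) is at most M_4 / (T (M − 1)(M − 3)), where M_4 = Σ_i d_i(d_i − 1)(d_i − 2)(d_i − 3). -/

import Mathlib

/-- The set `P` of labeled points: cell `P i` consists of `d i` points. -/
abbrev TPoint (n : ℕ) (d : Fin n → ℕ) : Type := (i : Fin n) × Fin (d i)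

/-- A temporal configuration of `(d, T)`: a partition of the points into pairs
(encoded as a fixed-point-free involution `pair`) together with a timestamp in `[1, T]`
(encoded as `Fin T`) assigned to each pair (encoded as a function on points that is
constant on each matched pair). -/
structure TConfig (n : ℕ) (d : Fin n → ℕ) (T : ℕ) where
  pair : TPoint n d → TPoint n d
  stamp : TPoint n d → Fin T
  invol : Function.Involutive pair
  nofix : ∀ x, pair x ≠ x
  compat : ∀ x, stamp (pair x) = stamp x

namespace TConfig

variable {n T : ℕ} {d : Fin n → ℕ}

theorem ext_of_eq {c c' : TConfig n d T} (hp : c.pair = c'.pair) (hs : c.stamp = c'.stamp) :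
    c = c' := by
  cases c; cases c'; simp_all

instance : Finite (TConfig n d T) :=
  Finite.of_injective (fun c : TConfig n d T => (c.pair, c.stamp)) fun _ _ h =>
    ext_of_eq (congrArg Prod.fst h) (congrArg Prod.snd h)

/-- Permute the points of a configuration by a permutation. -/
def permute (σ : Equiv.Perm (TPoint n d)) (c : TConfig n d T) : TConfig n d T where
  pair x := σ (c.pair (σ.symm x))
  stamp x := c.stamp (σ.symm x)
  invol x := by simp [c.invol _]
  nofix x h := c.nofix (σ.symm x) (by rw [Equiv.eq_symm_apply]; exact h)
  compat x := by simp [c.compat]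

theorem permute_injective (σ : Equiv.Perm (TPoint n d)) :
    Function.Injective (permute (T := T) σ) := by
  intro c c' h
  apply ext_of_eq <;> funext x
  · simpa [permute] using congrFun (congrArg pair h) (σ x)
  · simpa [permute] using congrFun (congrArg stamp h) (σ x)

open Classical in
/-- Change the timestamp of the pair containing `y` to `t`. -/
noncomputable def restamp (c : TConfig n d T) (y : TPoint n d) (t : Fin T) : TConfig n d T where
  pair := c.pair
  stamp x := if x = y ∨ x = c.pair y then t else c.stamp x
  invol := c.invol
  nofix := c.nofix
  compat x := by
    have h₁ : c.pair x = y ↔ x = c.pair y :=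
      ⟨fun h => by rw [← h, c.invol], fun h => by rw [h, c.invol]⟩
    have h₂ : c.pair x = c.pair y ↔ x = y := c.invol.injective.eq_iff
    simp only [h₁, h₂, c.compat, or_comm]

/-- Configurations that match `f 0` with `f 1` and `f 2` with `f 3`, with the same timestamp. -/
abbrev Contains (T : ℕ) (f : Fin 4 ↪ TPoint n d) : Type :=
  {c : TConfig n d T // c.pair (f 0) = f 1 ∧ c.pair (f 2) = f 3 ∧ c.stamp (f 2) = c.stamp (f 0)}

theorem card_contains_le (f g : Fin 4 ↪ TPoint n d) :
    Nat.card (Contains T f) ≤ Nat.card (Contains T g) := by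
  obtain ⟨σ, hσ⟩ := (Equiv.Perm.isMultiplyPretransitive (TPoint n d) 4).exists_smul_eq f g
  have hg (i : Fin 4) : g i = σ (f i) := by rw [← hσ]; rfl
  refine Nat.card_le_card_of_injective
    (fun c : Contains T f => (⟨c.1.permute σ, ?_⟩ : Contains T g)) fun c c' h => ?_
  · obtain ⟨h₁, h₂, h₃⟩ := c.2
    simp [permute, hg, h₁, h₂, h₃]
  · exact Subtype.ext (permute_injective σ (congrArg Subtype.val h))

theorem card_contains_eq (f g : Fin 4 ↪ TPoint n d) :
    Nat.card (Contains T f) = Nat.card (Contains T g) :=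
  (card_contains_le f g).antisymm (card_contains_le g f)

/-- Ordered pairs of points that lie in distinct matched pairs of `c`. -/
abbrev Separated (c : TConfig n d T) : Type :=
  {p : TPoint n d × TPoint n d // p.2 ≠ p.1 ∧ p.2 ≠ c.pair p.1}

theorem card_separated (c : TConfig n d T) :
    Nat.card c.Separated = (∑ i, d i) * (∑ i, d i - 2) := by
  classical
  let e : c.Separated ≃ (x : TPoint n d) × {y : TPoint n d // y ≠ x ∧ y ≠ c.pair x} :=
    { toFun p := ⟨p.1.1, p.1.2, p.2⟩
      invFun p := ⟨(p.1, p.2.1), p.2.2⟩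
      left_inv _ := rfl
      right_inv _ := rfl }
  have h (x : TPoint n d) :
      Nat.card {y : TPoint n d // y ≠ x ∧ y ≠ c.pair x} = ∑ i, d i - 2 := by
    have hs : Finset.univ.filter (fun y : TPoint n d => y ≠ x ∧ y ≠ c.pair x)
        = ({x, c.pair x} : Finset (TPoint n d))ᶜ := by
      ext y; simp
    rw [Nat.card_eq_fintype_card, Fintype.card_subtype, hs, Finset.card_compl,
      Finset.card_pair (c.nofix x).symm]
    simp
  rw [Nat.card_congr e, Nat.card_sigma, Finset.sum_congr rfl fun x _ => h x]
  simp

theorem mul_card_contains_le (f : Fin 4 ↪ TPoint n d) :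
    (∑ i, d i).descFactorial 4 * Nat.card (Contains T f) * T ≤
      Nat.card (TConfig n d T) * ((∑ i, d i) * (∑ i, d i - 2)) := by
  classical
  have := Fintype.ofFinite (TConfig n d T)
  have hl : Nat.card (((g : Fin 4 ↪ TPoint n d) × Contains T g) × Fin T) =
      (∑ i, d i).descFactorial 4 * Nat.card (Contains T f) * T := by
    rw [Nat.card_prod, Nat.card_sigma, Finset.sum_congr rfl fun g _ => card_contains_eq g f]
    simp [Fintype.card_embedding_eq]
  have hr : Nat.card ((c : TConfig n d T) × c.Separated) =
      Nat.card (TConfig n d T) * ((∑ i, d i) * (∑ i, d i - 2)) := by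
    rw [Nat.card_sigma, Finset.sum_congr rfl fun c _ => card_separated c]
    simp
  rw [← hl, ← hr]
  have hne (q : (g : Fin 4 ↪ TPoint n d) × Contains T g) :
      q.1 2 ≠ q.1 0 ∧ q.1 2 ≠ q.2.1.pair (q.1 0) := by
    rw [q.2.2.1]
    exact ⟨q.1.injective.ne (by decide), q.1.injective.ne (by decide)⟩
  refine Nat.card_le_card_of_injective
    (fun q => ⟨q.1.2.1.restamp (q.1.1 2) q.2, (q.1.1 0, q.1.1 2), hne q.1⟩) ?_
  rintro ⟨⟨g, c, h₁, h₂, h₃⟩, t⟩ ⟨⟨g', c', h₁', h₂', h₃'⟩, t'⟩ h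
  have hc : c.restamp (g 2) t = c'.restamp (g' 2) t' := congrArg Sigma.fst h
  have hxy := congrArg (fun q : (c : TConfig n d T) × c.Separated => q.2.1) h
  simp only [Prod.mk.injEq] at hxy
  obtain ⟨hx, hy⟩ := hxy
  have hp : c.pair = c'.pair := by simpa only [restamp] using congrArg pair hc
  have hst := congrArg stamp hc
  have hg : g = g' := by
    ext1 i
    fin_cases i
    · exact hx
    · change g 1 = g' 1
      rw [← h₁, ← h₁', hp, hx]
    · exact hy
    · change g 3 = g' 3
      rw [← h₂, ← h₂', hp, hy]
  subst hg
  have ht : t = t' := by simpa [restamp] using congrFun hst (g 2)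
  subst ht
  have hsep (z : TPoint n d) (hz : ¬(z = g 2 ∨ z = g 3)) : c.stamp z = c'.stamp z := by
    have := congrFun hst z
    simpa only [restamp, h₂, h₂', if_neg hz] using this
  have h0 : c.stamp (g 0) = c'.stamp (g 0) := hsep _ (by simp)
  have h2 : c.stamp (g 2) = c'.stamp (g 2) := by rw [h₃, h₃', h0]
  have hcc : c = c' := by
    refine ext_of_eq hp (funext fun z => ?_)
    by_cases hz : z = g 2 ∨ z = g 3
    · rcases hz with rfl | rfl
      · exact h2
      · rw [← c.compat, ← c'.compat, ← h₂, c.invol, h₂, ← h₂', c'.invol, h2]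
    · exact hsep z hz
  subst hcc
  rfl

/-- Ordered quadruples of distinct points in a common cell. -/
abbrev CellQuad (d : Fin n → ℕ) : Type :=
  {f : Fin 4 ↪ TPoint n d // ∀ i, (f i).1 = (f 0).1}

theorem card_cellQuad_le : Nat.card (CellQuad d) ≤ ∑ i, (d i).descFactorial 4 := by
  have hr : Nat.card ((i : Fin n) × (Fin 4 ↪ Fin (d i))) = ∑ i, (d i).descFactorial 4 := by
    rw [Nat.card_sigma]
    simp [Fintype.card_embedding_eq]
  rw [← hr]
  refine Nat.card_le_card_of_surjective
    (fun q : (i : Fin n) × (Fin 4 ↪ Fin (d i)) =>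
      (⟨q.2.trans (Function.Embedding.sigmaMk (β := fun i => Fin (d i)) q.1),
        fun _ => rfl⟩ : CellQuad d)) ?_
  rintro ⟨f, hf⟩
  have hex (i : Fin 4) : ∃ y : Fin (d (f 0).1), f i = ⟨(f 0).1, y⟩ := by
    have := hf i
    generalize f i = z at this ⊢
    obtain ⟨j, y⟩ := z
    subst this
    exact ⟨y, rfl⟩
  choose y hy using hex
  refine ⟨⟨(f 0).1, y, fun i j hij => f.injective (by rw [hy i, hy j, hij])⟩, ?_⟩
  apply Subtype.ext
  ext1 i
  exact (hy i).symm

/-- Witnesses of temporal double-loops: a configuration together with a point on each of two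
distinct loops at the same cell that have the same timestamp. -/
abbrev DoubleLoop (n : ℕ) (d : Fin n → ℕ) (T : ℕ) : Type :=
  {p : TConfig n d T × TPoint n d × TPoint n d //
    (p.1.pair p.2.1).1 = (p.2.1).1 ∧
    (p.2.2).1 = (p.2.1).1 ∧ (p.1.pair p.2.2).1 = (p.2.1).1 ∧
    p.2.2 ≠ p.2.1 ∧ p.2.2 ≠ p.1.pair p.2.1 ∧
    p.1.stamp p.2.2 = p.1.stamp p.2.1}

theorem pair_quad_injective (c : TConfig n d T) {x y : TPoint n d} (h₁ : y ≠ x)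
    (h₂ : y ≠ c.pair x) : Function.Injective ![x, c.pair x, y, c.pair y] := by
  have h₃ : c.pair y ≠ x := fun h => h₂ (by rw [← h, c.invol])
  have h₄ : c.pair y ≠ c.pair x := fun h => h₁ (c.invol.injective h)
  have h₅ := c.nofix x
  have h₆ := c.nofix y
  intro i j hij
  fin_cases i <;> fin_cases j <;> simp_all [eq_comm]

theorem card_doubleLoop_le (f : Fin 4 ↪ TPoint n d) :
    Nat.card (DoubleLoop n d T) ≤ (∑ i, (d i).descFactorial 4) * Nat.card (Contains T f) := by
  have := Fintype.ofFinite (CellQuad d)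
  have hr : Nat.card ((q : CellQuad d) × Contains T q.1) =
      Nat.card (CellQuad d) * Nat.card (Contains T f) := by
    rw [Nat.card_sigma, Finset.sum_congr rfl fun q _ => card_contains_eq q.1 f]
    simp
  refine le_trans ?_ (hr.le.trans (Nat.mul_le_mul_right _ card_cellQuad_le))
  refine Nat.card_le_card_of_surjective
    (fun q : (q : CellQuad d) × Contains T q.1 =>
      (⟨(q.2.1, q.1.1 0, q.1.1 2), ?_⟩ : DoubleLoop n d T)) ?_
  · obtain ⟨⟨g, hg⟩, c, h₁, h₂, h₃⟩ := q
    simp only [h₁, h₂]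
    exact ⟨hg 1, hg 2, hg 3, g.injective.ne (by decide), g.injective.ne (by decide), h₃⟩
  · rintro ⟨⟨c, x, y⟩, h₁, h₂, h₃, h₄, h₅, h₆⟩
    refine ⟨⟨⟨⟨_, pair_quad_injective c h₄ h₅⟩, fun i => ?_⟩, c, rfl, rfl, h₆⟩, rfl⟩
    fin_cases i
    exacts [rfl, h₁, h₂, h₃]

end TConfig

theorem cast_descFactorial_four (k : ℕ) :
    ((k.descFactorial 4 : ℕ) : ℝ) = (k : ℝ) * (k - 1) * (k - 2) * (k - 3) := by
  rcases k with _ | _ | _ | k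
  · simp
  · simp
  · norm_num [Nat.descFactorial]
  · simp only [Nat.descFactorial_succ, Nat.descFactorial_zero]
    rw [show k + 1 + 1 + 1 - 3 = k by omega, show k + 1 + 1 + 1 - 2 = k + 1 by omega,
      show k + 1 + 1 + 1 - 1 = k + 2 by omega]
    push_cast
    ring

/-- The expected number of temporal double-loops (unordered pairs `{e, e'}` of distinct
matched pairs with all four points in the same cell and the same timestamp) of a uniformly
random temporal configuration is at most `M₄ / (T (M-1)(M-3))`.  Each such unordered pair
is witnessed by exactly `8` triples (configuration, x, y) below. -/
theorem stmt7 (n T : ℕ) (d : Fin n → ℕ) (M : ℕ) (hM : M = ∑ i, d i)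
    (hEven : Even M) (hM4 : 4 ≤ M) (hT : 1 ≤ T) :
    (Nat.card {p : TConfig n d T × TPoint n d × TPoint n d //
        (p.1.pair p.2.1).1 = (p.2.1).1 ∧
        (p.2.2).1 = (p.2.1).1 ∧ (p.1.pair p.2.2).1 = (p.2.1).1 ∧
        p.2.2 ≠ p.2.1 ∧ p.2.2 ≠ p.1.pair p.2.1 ∧
        p.1.stamp p.2.2 = p.1.stamp p.2.1} : ℝ) /
      (8 * Nat.card (TConfig n d T)) ≤
    (∑ i, (d i : ℝ) * ((d i : ℝ) - 1) * ((d i : ℝ) - 2) * ((d i : ℝ) - 3)) /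
      ((T : ℝ) * ((M : ℝ) - 1) * ((M : ℝ) - 3)) := by
  have hcard : Fintype.card (Fin 4) ≤ Fintype.card (TPoint n d) := by simpa [← hM] using hM4
  obtain ⟨f⟩ := Function.Embedding.nonempty_of_card_le hcard
  have hL := TConfig.card_doubleLoop_le (T := T) f
  have hK := TConfig.mul_card_contains_le (T := T) f
  rw [← hM] at hK
  change (Nat.card (TConfig.DoubleLoop n d T) : ℝ) / _ ≤ _
  simp_rw [← cast_descFactorial_four]
  generalize Nat.card (TConfig.DoubleLoop n d T) = L at *
  generalize Nat.card (TConfig.Contains T f) = K at *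
  generalize Nat.card (TConfig n d T) = N at *
  rw [← Nat.cast_sum]
  generalize ∑ i, (d i).descFactorial 4 = S at *
  have hM4' : (4 : ℝ) ≤ M := by exact_mod_cast hM4
  have hT' : (0 : ℝ) < T := by exact_mod_cast hT
  have hD : (0 : ℝ) < T * (M - 1) * (M - 3) :=
    mul_pos (mul_pos hT' (by linarith)) (by linarith)
  have hL' : (L : ℝ) ≤ S * K := by exact_mod_cast hL
  have hK' : (K : ℝ) * (T * (M - 1) * (M - 3)) ≤ N := by
    have h : ((M.descFactorial 4 * K * T : ℕ) : ℝ) ≤ ((N * (M * (M - 2)) : ℕ) : ℝ) := by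
      exact_mod_cast hK
    push_cast [cast_descFactorial_four, Nat.cast_sub (show 2 ≤ M by omega)] at h
    have hpos : (0 : ℝ) < M * (M - 2) := mul_pos (by linarith) (by linarith)
    refine le_of_mul_le_mul_right ?_ hpos
    linarith
  rcases N.eq_zero_or_pos with rfl | hN
  · simp only [Nat.cast_zero, mul_zero, div_zero]
    positivity
  · have hN' : (0 : ℝ) < N := by exact_mod_cast hN
    rw [div_le_div_iff₀ (by positivity) hD]
    calc (L : ℝ) * (T * (M - 1) * (M - 3)) ≤ S * K * (T * (M - 1) * (M - 3)) := by gcongr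
      _ = S * (K * (T * (M - 1) * (M - 3))) := by ring
      _ ≤ S * N := by gcongr
      _ ≤ S * (8 * N) := by gcongr; linarith
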